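/- For n ≥ 2: (i) tr_n(e_{n−1} X g_{n−1}) = tr_n(g_{n−1} X e_{n−1}) for every X ∈ Y_{d,n−1}^B; (ii) tr_{n−1}(tr_n(e_{n−1} Y)) = tr_{n−1}(tr_n(Y e_{n−1})) for every Y ∈ Y_{d,n}^B. -/

import Mathlib

set_option maxHeartbeats 1000000
set_option synthInstance.maxHeartbeats 400000

noncomputable section

/-- The field `L = ℂ(u,v,z)` of rational functions in three indeterminates over `ℂ`. -/
abbrev Kf : Type := FractionRing (MvPolynomial (Fin 3) ℂ)

/-- The indeterminate `u`. -/
def uu : Kf := algebraMap (MvPolynomial (Fin 3) ℂ) Kf (MvPolynomial.X 0)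

/-- The indeterminate `v`. -/
def vv : Kf := algebraMap (MvPolynomial (Fin 3) ℂ) Kf (MvPolynomial.X 1)

/-- The indeterminate `z`. -/
def zz : Kf := algebraMap (MvPolynomial (Fin 3) ℂ) Kf (MvPolynomial.X 2)

/-- Generators of the framization of the Hecke algebra of type B on `n` strands:
`b` is the generator `b₁`, `g i` is the braiding generator `g_{i+1}` (`i : Fin (n-1)`),
and `t j` is the framing generator `t_{j+1}` (`j : Fin n`). -/
inductive Gen (n : ℕ) : Type
  | b : Gen n
  | g : Fin (n - 1) → Gen n
  | t : Fin n → Gen n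

/-- The free algebra on the generators. -/
abbrev FA (n : ℕ) : Type := FreeAlgebra Kf (Gen n)

/-- The generator `b₁` in the free algebra. -/
def Bb (n : ℕ) : FA n := FreeAlgebra.ι Kf Gen.b

/-- The generator `g_i` (for `1 ≤ i ≤ n-1`) in the free algebra; junk value `1` out of range. -/
def Gg (n i : ℕ) : FA n :=
  if h : 1 ≤ i ∧ i ≤ n - 1 then FreeAlgebra.ι Kf (Gen.g ⟨i - 1, by omega⟩) else 1

/-- The generator `t_j` (for `1 ≤ j ≤ n`) in the free algebra; junk value `1` out of range. -/
def Tt (n j : ℕ) : FA n :=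
  if h : 1 ≤ j ∧ j ≤ n then FreeAlgebra.ι Kf (Gen.t ⟨j - 1, by omega⟩) else 1

/-- The element `e_i = (1/d) ∑_{m=0}^{d-1} t_i^m t_{i+1}^{d-m}` in the free algebra. -/
def eF (d n i : ℕ) : FA n :=
  (d : Kf)⁻¹ • ∑ m ∈ Finset.range d, Tt n i ^ m * Tt n (i + 1) ^ (d - m)

/-- The element `f₁ = (1/d) ∑_{m=0}^{d-1} t₁^m` in the free algebra. -/
def fF (d n : ℕ) : FA n :=
  (d : Kf)⁻¹ • ∑ m ∈ Finset.range d, Tt n 1 ^ m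

/-- The action of the simple transposition `s_i` on indices: swaps `i` and `i+1`. -/
def sAct (i j : ℕ) : ℕ := if j = i then i + 1 else if j = i + 1 then i else j

/-- The defining relations of the framization `Y_{d,n}^B` of the Hecke algebra of type B. -/
inductive YBrel (d n : ℕ) : FA n → FA n → Prop
  | gg : ∀ i j : ℕ, 1 ≤ i → i ≤ n - 1 → 1 ≤ j → j ≤ n - 1 → (i + 1 < j ∨ j + 1 < i) →
      YBrel d n (Gg n i * Gg n j) (Gg n j * Gg n i)
  | braid : ∀ i : ℕ, 1 ≤ i → i ≤ n - 2 →
      YBrel d n (Gg n i * Gg n (i + 1) * Gg n i) (Gg n (i + 1) * Gg n i * Gg n (i + 1))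
  | bg : ∀ i : ℕ, 2 ≤ i → i ≤ n - 1 → YBrel d n (Bb n * Gg n i) (Gg n i * Bb n)
  | bgbg : YBrel d n (Bb n * Gg n 1 * Bb n * Gg n 1) (Gg n 1 * Bb n * Gg n 1 * Bb n)
  | tt : ∀ i j : ℕ, 1 ≤ i → i ≤ n → 1 ≤ j → j ≤ n →
      YBrel d n (Tt n i * Tt n j) (Tt n j * Tt n i)
  | tg : ∀ i j : ℕ, 1 ≤ i → i ≤ n - 1 → 1 ≤ j → j ≤ n →
      YBrel d n (Tt n j * Gg n i) (Gg n i * Tt n (sAct i j))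
  | tb : ∀ i : ℕ, 1 ≤ i → i ≤ n → YBrel d n (Tt n i * Bb n) (Bb n * Tt n i)
  | td : ∀ i : ℕ, 1 ≤ i → i ≤ n → YBrel d n (Tt n i ^ d) 1
  | gsq : ∀ i : ℕ, 1 ≤ i → i ≤ n - 1 →
      YBrel d n (Gg n i ^ 2) (1 + (uu - uu⁻¹) • (eF d n i * Gg n i))
  | bsq : YBrel d n (Bb n ^ 2) (1 + (vv - vv⁻¹) • (fF d n * Bb n))

/-- The framization of the Hecke algebra of type B, `Y_{d,n}^B`. -/
abbrev YB (d n : ℕ) : Type := RingQuot (YBrel d n)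

instance (d n : ℕ) : Ring (YB d n) := RingQuot.instRing (YBrel d n)

instance (d n : ℕ) : Algebra Kf (YB d n) := RingQuot.instAlgebra _

instance (d n : ℕ) : Module Kf (YB d n) := Algebra.toModule

/-- The canonical projection from the free algebra onto `Y_{d,n}^B`. -/
def mkY (d n : ℕ) : FA n →ₐ[Kf] YB d n := RingQuot.mkAlgHom Kf (YBrel d n)

/-- The generator `b₁` of `Y_{d,n}^B`. -/
def bY (d n : ℕ) : YB d n := mkY d n (Bb n)

/-- The generator `g_i` of `Y_{d,n}^B`. -/
def gY (d n : ℕ) (i : ℕ) : YB d n := mkY d n (Gg n i)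

/-- The generator `t_j` of `Y_{d,n}^B`. -/
def tY (d n : ℕ) (j : ℕ) : YB d n := mkY d n (Tt n j)

/-- The idempotent `e_i` of `Y_{d,n}^B`. -/
def eY (d n : ℕ) (i : ℕ) : YB d n := mkY d n (eF d n i)

/-- The idempotent `f₁` of `Y_{d,n}^B`. -/
def fY (d n : ℕ) : YB d n := mkY d n (fF d n)

/-- The element `g_i⁻¹ = g_i - (u - u⁻¹) e_i`. -/
def gInv (d n i : ℕ) : YB d n := gY d n i - (uu - uu⁻¹) • eY d n i

/-- The elements `b_k := g_{k-1} ⋯ g_1 b_1 g_1⁻¹ ⋯ g_{k-1}⁻¹` for `2 ≤ k ≤ n`,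
defined by `b_k = g_{k-1} b_{k-1} g_{k-1}⁻¹`; with `b_1` the generator `b₁`. -/
def bk (d n : ℕ) : ℕ → YB d n
  | 0 => 1
  | 1 => bY d n
  | (k + 2) => gY d n (k + 1) * bk d n (k + 1) * gInv d n (k + 1)

/-- The descending product `g_{k-1} g_{k-2} ⋯ g_j`. -/
def gRange (d n j k : ℕ) : YB d n := (((List.range' j (k - j)).reverse).map (gY d n)).prod

/-- The elements `𝔪⁺_{k,j,m}`: `𝔪⁺_{k,k,m} = t_k^m` and
`𝔪⁺_{k,j,m} = g_{k-1} ⋯ g_j t_j^m` for `j < k`. -/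
def mPlus (d n k j m : ℕ) : YB d n :=
  if j = k then tY d n k ^ m else gRange d n j k * tY d n j ^ m

/-- The elements `𝔪⁻_{k,j,m}`: `𝔪⁻_{k,k,m} = t_k^m b_k` and
`𝔪⁻_{k,j,m} = g_{k-1} ⋯ g_j b_j t_j^m` for `j < k`. -/
def mMinus (d n k j m : ℕ) : YB d n :=
  if j = k then tY d n k ^ m * bk d n k else gRange d n j k * (bk d n j * tY d n j ^ m)

/-- The subsets `M_{d,k}` of `Y_{d,n}^B`:
`M_{d,1} = {t₁^m, t₁^m b₁}` and `M_{d,k} = {t_k^m, t_k^m b_k, g_{k-1} x : x ∈ M_{d,k-1}}`. -/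
def Mset (d n : ℕ) : ℕ → Set (YB d n)
  | 0 => {1}
  | 1 => {x | ∃ m ≤ d - 1, x = tY d n 1 ^ m ∨ x = tY d n 1 ^ m * bY d n}
  | (k + 2) => {x |
      (∃ m ≤ d - 1, x = tY d n (k + 2) ^ m ∨ x = tY d n (k + 2) ^ m * bk d n (k + 2)) ∨
      ∃ y ∈ Mset d n (k + 1), x = gY d n (k + 1) * y}

/-- The set `𝖢_n` of all products `𝔪_1 𝔪_2 ⋯ 𝔪_n` with `𝔪_i ∈ M_{d,i}`. -/
def Cset (d n : ℕ) : Set (YB d n) :=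
  {x | ∃ f : Fin n → YB d n, (∀ i : Fin n, f i ∈ Mset d n (i.val + 1)) ∧
    x = (List.ofFn f).prod}

/-- Characterization of the natural inclusion `Y_{d,n}^B ⊆ Y_{d,n+1}^B`:
the algebra map sending generators to the generators of the same name. -/
def IsIncl (d n : ℕ) (inc : YB d n →ₐ[Kf] YB d (n + 1)) : Prop :=
  inc (bY d n) = bY d (n + 1) ∧
  (∀ i, 1 ≤ i → i ≤ n - 1 → inc (gY d n i) = gY d (n + 1) i) ∧
  (∀ j, 1 ≤ j → j ≤ n → inc (tY d n j) = tY d (n + 1) j)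

/-- Characterization of the relative trace `tr_{n+1} : Y_{d,n+1}^B → Y_{d,n}^B`
(with respect to trace parameters `x`, `y`): it is the `L`-linear map defined on the
basis `𝖢_{n+1}` by `tr(w t_{n+1}^m) = x_m w`, `tr(w b_{n+1} t_{n+1}^m) = y_m w`, and
`tr(w 𝔪^±_{n+1,k,m}) = z (w 𝔪^±_{n,k,m})` for `k < n+1`, where `w ∈ 𝖢_n`. -/
def IsRelTrace (d : ℕ) (x y : ZMod d → Kf) (n : ℕ)
    (inc : YB d n →ₐ[Kf] YB d (n + 1)) (tr : YB d (n + 1) →ₗ[Kf] YB d n) : Prop :=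
  ∀ w ∈ Cset d n, ∀ m : ℕ, m ≤ d - 1 →
    (tr (inc w * tY d (n + 1) (n + 1) ^ m) = x (m : ZMod d) • w) ∧
    (tr (inc w * (bk d (n + 1) (n + 1) * tY d (n + 1) (n + 1) ^ m)) = y (m : ZMod d) • w) ∧
    (∀ k, 1 ≤ k → k ≤ n →
      tr (inc w * mPlus d (n + 1) (n + 1) k m) = zz • (w * mPlus d n n k m) ∧
      tr (inc w * mMinus d (n + 1) (n + 1) k m) = zz • (w * mMinus d n n k m))

/-- Characterization of the trace `tr_1 : Y_{d,1}^B → L`: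
`tr_1(t₁^a) = x_a` and `tr_1(b₁ t₁^a) = y_a`. -/
def IsTr1 (d : ℕ) (x y : ZMod d → Kf) (tr1 : YB d 1 →ₗ[Kf] Kf) : Prop :=
  ∀ a : ℕ, a ≤ d - 1 →
    tr1 (tY d 1 1 ^ a) = x (a : ZMod d) ∧ tr1 (bY d 1 * tY d 1 1 ^ a) = y (a : ZMod d)

/-- The Markov trace tower `Tr_{m+1} = tr_1 ∘ tr_2 ∘ ⋯ ∘ tr_{m+1} : Y_{d,m+1}^B → L`,
built from the relative traces (`tr k` here is the relative trace
`tr_{k+2} : Y_{d,k+2}^B → Y_{d,k+1}^B`). -/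
def TrT (d : ℕ) (tr1 : YB d 1 →ₗ[Kf] Kf)
    (tr : (k : ℕ) → (YB d (k + 2) →ₗ[Kf] YB d (k + 1))) :
    (m : ℕ) → (YB d (m + 1) →ₗ[Kf] Kf)
  | 0 => tr1
  | (m + 1) => (TrT d tr1 tr m).comp (tr m)

/-! ### Relations in `Y_{d,n}^B` -/

section Relations

variable {d n : ℕ}

theorem mkY_eq_of_rel {a b : FA n} (h : YBrel d n a b) : mkY d n a = mkY d n b :=
  RingQuot.mkAlgHom_rel Kf h

theorem gY_comm {i j : ℕ} (hi : 1 ≤ i) (hi' : i ≤ n - 1) (hj : 1 ≤ j) (hj' : j ≤ n - 1)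
    (hij : i + 1 < j ∨ j + 1 < i) : Commute (gY d n i) (gY d n j) := by
  have h := mkY_eq_of_rel (d := d) (YBrel.gg i j hi hi' hj hj' hij)
  simp only [map_mul] at h
  exact h

theorem gY_braid {i : ℕ} (hi : 1 ≤ i) (hi' : i ≤ n - 2) :
    gY d n i * gY d n (i + 1) * gY d n i = gY d n (i + 1) * gY d n i * gY d n (i + 1) := by
  have h := mkY_eq_of_rel (d := d) (YBrel.braid i hi hi')
  simp only [map_mul] at h
  exact h

theorem bY_gY_comm {i : ℕ} (hi : 2 ≤ i) (hi' : i ≤ n - 1) : Commute (bY d n) (gY d n i) := by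
  have h := mkY_eq_of_rel (d := d) (YBrel.bg i hi hi')
  simp only [map_mul] at h
  exact h

theorem bY_gY_bY_gY : bY d n * gY d n 1 * bY d n * gY d n 1 =
    gY d n 1 * bY d n * gY d n 1 * bY d n := by
  have h := mkY_eq_of_rel (d := d) (YBrel.bgbg (n := n))
  simp only [map_mul] at h
  exact h

theorem tY_eq_one {j : ℕ} (h : ¬(1 ≤ j ∧ j ≤ n)) : tY d n j = 1 := by
  simp [tY, Tt, h]

theorem tY_comm (i j : ℕ) : Commute (tY d n i) (tY d n j) := by
  by_cases hi : 1 ≤ i ∧ i ≤ n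
  · by_cases hj : 1 ≤ j ∧ j ≤ n
    · have h := mkY_eq_of_rel (d := d) (YBrel.tt i j hi.1 hi.2 hj.1 hj.2)
      simp only [map_mul] at h
      exact h
    · rw [tY_eq_one hj]; exact Commute.one_right _
  · rw [tY_eq_one hi]; exact Commute.one_left _

theorem tY_bY_comm (i : ℕ) : Commute (tY d n i) (bY d n) := by
  by_cases hi : 1 ≤ i ∧ i ≤ n
  · have h := mkY_eq_of_rel (d := d) (YBrel.tb i hi.1 hi.2)
    simp only [map_mul] at h
    exact h
  · rw [tY_eq_one hi]; exact Commute.one_left _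

theorem tY_pow_card (i : ℕ) : tY d n i ^ d = 1 := by
  by_cases hi : 1 ≤ i ∧ i ≤ n
  · have h := mkY_eq_of_rel (d := d) (YBrel.td i hi.1 hi.2)
    simp only [map_pow, map_one] at h
    exact h
  · rw [tY_eq_one hi, one_pow]

theorem tY_pow_mod (i m : ℕ) : tY d n i ^ (m % d) = tY d n i ^ m :=
  (pow_eq_pow_mod m (tY_pow_card i)).symm

theorem semiconjBy_gY_tY {i j : ℕ} (hi : 1 ≤ i) (hi' : i ≤ n - 1) (hj : 1 ≤ j) (hj' : j ≤ n) :
    SemiconjBy (gY d n i) (tY d n (sAct i j)) (tY d n j) := by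
  have := mkY_eq_of_rel (d := d) (YBrel.tg i j hi hi' hj hj')
  simp only [map_mul] at this
  exact this.symm

theorem semiconjBy_gY_tY_succ {i : ℕ} (hi : 1 ≤ i) (hi' : i ≤ n - 1) :
    SemiconjBy (gY d n i) (tY d n (i + 1)) (tY d n i) := by
  simpa [sAct] using semiconjBy_gY_tY (d := d) hi hi' hi (by omega)

theorem semiconjBy_gY_tY_self {i : ℕ} (hi : 1 ≤ i) (hi' : i ≤ n - 1) :
    SemiconjBy (gY d n i) (tY d n i) (tY d n (i + 1)) := by
  simpa [sAct] using semiconjBy_gY_tY (d := d) (j := i + 1) hi hi' (by omega) (by omega)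

theorem gY_tY_comm {i j : ℕ} (hi : 1 ≤ i) (hi' : i ≤ n - 1) (hj : 1 ≤ j) (hj' : j ≤ n)
    (hne : j ≠ i) (hne' : j ≠ i + 1) : Commute (gY d n i) (tY d n j) := by
  have h := semiconjBy_gY_tY (d := d) hi hi' hj hj'
  rwa [sAct, if_neg hne, if_neg hne'] at h

theorem eY_eq_sum (i : ℕ) : eY d n i =
    (d : Kf)⁻¹ • ∑ m ∈ Finset.range d, tY d n i ^ m * tY d n (i + 1) ^ (d - m) := by
  simp only [eY, eF, map_smul, map_sum, map_mul, map_pow, tY]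

theorem fY_eq_sum : fY d n = (d : Kf)⁻¹ • ∑ m ∈ Finset.range d, tY d n 1 ^ m := by
  simp only [fY, fF, map_smul, map_sum, map_pow, tY]

theorem gY_mul_self {i : ℕ} (hi : 1 ≤ i) (hi' : i ≤ n - 1) :
    gY d n i * gY d n i = 1 + (uu - uu⁻¹) • (eY d n i * gY d n i) := by
  have h := mkY_eq_of_rel (d := d) (YBrel.gsq i hi hi')
  simp only [map_add, map_one, map_smul, map_mul, sq] at h
  exact h

theorem bY_mul_self : bY d n * bY d n = 1 + (vv - vv⁻¹) • (fY d n * bY d n) := by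
  have h := mkY_eq_of_rel (d := d) (YBrel.bsq (n := n))
  simp only [map_add, map_one, map_smul, map_mul, sq] at h
  exact h

theorem sum_range_sub_comm {M : Type*} [AddCommMonoid M] (F : ℕ → ℕ → M) (k : ℕ)
    (h : F 0 k = F k 0) :
    ∑ m ∈ Finset.range k, F m (k - m) = ∑ m ∈ Finset.range k, F (k - m) m := by
  cases k with
  | zero => simp
  | succ k =>
    rw [Finset.sum_range_succ', Finset.sum_range_succ', ← Finset.sum_range_reflect]
    simp only [Nat.sub_zero, h]
    congr 1
    refine Finset.sum_congr rfl fun m hm => ?_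
    have := Finset.mem_range.1 hm
    congr 1 <;> omega

theorem gY_eY_comm {i : ℕ} (hi : 1 ≤ i) (hi' : i ≤ n - 1) : Commute (gY d n i) (eY d n i) := by
  have h : ∑ m ∈ Finset.range d, tY d n i ^ m * tY d n (i + 1) ^ (d - m) =
      ∑ m ∈ Finset.range d, tY d n i ^ (d - m) * tY d n (i + 1) ^ m :=
    sum_range_sub_comm (fun a b => tY d n i ^ a * tY d n (i + 1) ^ b) d
      (by simp only [tY_pow_card, pow_zero])
  unfold Commute
  nth_rewrite 2 [eY_eq_sum]
  rw [h, eY_eq_sum]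
  refine SemiconjBy.smul_right ?_ _
  unfold SemiconjBy
  rw [Finset.mul_sum, Finset.sum_mul]
  refine Finset.sum_congr rfl fun m _ => ?_
  rw [((tY_comm i (i + 1)).pow_pow (d - m) m).eq]
  exact ((semiconjBy_gY_tY_self hi hi').pow_right m).mul_right
    ((semiconjBy_gY_tY_succ hi hi').pow_right (d - m))

theorem YB_induction {p : YB d n → Prop} (scalar : ∀ r : Kf, p (algebraMap Kf (YB d n) r))
    (add : ∀ a b, p a → p b → p (a + b)) (mul : ∀ a b, p a → p b → p (a * b))
    (hb : p (bY d n)) (hg : ∀ i, 1 ≤ i → i ≤ n - 1 → p (gY d n i))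
    (ht : ∀ j, 1 ≤ j → j ≤ n → p (tY d n j)) (a : YB d n) : p a := by
  obtain ⟨w, rfl⟩ : ∃ w, mkY d n w = a := RingQuot.mkAlgHom_surjective Kf (YBrel d n) a
  induction w using FreeAlgebra.induction with
  | grade0 r => simpa only [AlgHom.commutes] using scalar r
  | grade1 x =>
    cases x with
    | b => exact hb
    | g i =>
      have := hg (i + 1) (by omega) (by omega)
      rwa [gY, Gg, dif_pos (by omega)] at this
    | t j =>
      have := ht (j + 1) (by omega) (by omega)
      rwa [tY, Tt, dif_pos (by omega)] at this
  | mul a b ha hb => rw [map_mul]; exact mul _ _ ha hb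
  | add a b ha hb => rw [map_add]; exact add _ _ ha hb

theorem submodule_eq_top {V : Submodule Kf (YB d n)} (one : 1 ∈ V)
    (hb : ∀ w ∈ V, w * bY d n ∈ V)
    (hg : ∀ i, 1 ≤ i → i ≤ n - 1 → ∀ w ∈ V, w * gY d n i ∈ V)
    (ht : ∀ j, 1 ≤ j → j ≤ n → ∀ w ∈ V, w * tY d n j ∈ V) : V = ⊤ := by
  refine (Submodule.eq_top_iff' ).2 fun a => ?_
  suffices h : ∀ w ∈ V, w * a ∈ V by simpa using h 1 one
  induction a using YB_induction with
  | scalar r =>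
    intro w hw
    rw [← Algebra.commutes, ← Algebra.smul_def]
    exact V.smul_mem r hw
  | add a b ha hb =>
    intro w hw
    rw [mul_add]
    exact V.add_mem (ha w hw) (hb w hw)
  | mul a b ha hb =>
    intro w hw
    rw [← mul_assoc]
    exact hb _ (ha w hw)
  | hb => exact hb
  | hg i hi hi' => exact hg i hi hi'
  | ht j hj hj' => exact ht j hj hj'

end Relations

/-! ### The tower of inclusions -/

section Inclusions

variable {d : ℕ} {inc : (k : ℕ) → (YB d k →ₐ[Kf] YB d (k + 1))}
  (hinc : ∀ k, 1 ≤ k → IsIncl d k (inc k))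

include hinc

theorem inc_bY {k : ℕ} (hk : 1 ≤ k) : inc k (bY d k) = bY d (k + 1) := (hinc k hk).1

theorem inc_gY {k i : ℕ} (hk : 1 ≤ k) (hi : 1 ≤ i) (hi' : i ≤ k - 1) :
    inc k (gY d k i) = gY d (k + 1) i := (hinc k hk).2.1 i hi hi'

theorem inc_tY {k j : ℕ} (hk : 1 ≤ k) (hj : 1 ≤ j) (hj' : j ≤ k) :
    inc k (tY d k j) = tY d (k + 1) j := (hinc k hk).2.2 j hj hj'

theorem inc_eY {k i : ℕ} (hi : 1 ≤ i) (hi' : i + 1 ≤ k) :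
    inc k (eY d k i) = eY d (k + 1) i := by
  have hk : 1 ≤ k := by omega
  simp only [eY_eq_sum, map_smul, map_sum, map_mul, map_pow, inc_tY hinc hk hi (by omega),
    inc_tY hinc hk (j := i + 1) (by omega) hi']

theorem inc_bk {k j : ℕ} (hj : 1 ≤ j) (hj' : j ≤ k) : inc k (bk d k j) = bk d (k + 1) j := by
  induction j, hj using Nat.le_induction with
  | base => exact inc_bY hinc hj'
  | succ j hj ih =>
    obtain ⟨i, rfl⟩ := Nat.exists_eq_add_of_le' hj
    simp only [bk, gInv, map_mul, map_sub, map_smul, ih (by omega),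
      inc_gY hinc (k := k) (i := i + 1) (by omega) (by omega) (by omega),
      inc_eY hinc (k := k) (i := i + 1) (by omega) hj']

theorem inc_mem_Mset {k j : ℕ} (hj : 1 ≤ j) (hj' : j ≤ k) {a : YB d k} (ha : a ∈ Mset d k j) :
    inc k a ∈ Mset d (k + 1) j := by
  induction j, hj using Nat.le_induction generalizing a with
  | base =>
    obtain ⟨m, hm, rfl | rfl⟩ := ha
    · exact ⟨m, hm, Or.inl (by rw [map_pow, inc_tY hinc hj' le_rfl hj'])⟩
    · exact ⟨m, hm, Or.inr (by
        rw [map_mul, map_pow, inc_tY hinc hj' le_rfl hj', inc_bY hinc hj'])⟩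
  | succ j hj ih =>
    obtain ⟨i, rfl⟩ := Nat.exists_eq_add_of_le' hj
    have ht := inc_tY hinc (k := k) (j := i + 1 + 1) (by omega) (by omega) hj'
    obtain ⟨m, hm, rfl | rfl⟩ | ⟨y, hy, rfl⟩ := ha
    · exact Or.inl ⟨m, hm, Or.inl (by rw [map_pow, ht])⟩
    · exact Or.inl ⟨m, hm, Or.inr (by
        rw [map_mul, map_pow, ht, inc_bk hinc (by omega) hj'])⟩
    · exact Or.inr ⟨inc k y, ih (by omega) hy, by
        rw [map_mul, inc_gY hinc (by omega) (by omega) (by omega)]⟩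

theorem commute_inc {k : ℕ} (hk : 1 ≤ k) {x : YB d (k + 1)} (hb : Commute x (bY d (k + 1)))
    (hg : ∀ i, 1 ≤ i → i ≤ k - 1 → Commute x (gY d (k + 1) i))
    (ht : ∀ j, 1 ≤ j → j ≤ k → Commute x (tY d (k + 1) j)) (a : YB d k) :
    Commute x (inc k a) := by
  induction a using YB_induction with
  | scalar r => rw [AlgHom.commutes]; exact Algebra.commute_algebraMap_right r x
  | add a b ha hb => rw [map_add]; exact ha.add_right hb
  | mul a b ha hb => rw [map_mul]; exact ha.mul_right hb
  | hb => rwa [inc_bY hinc hk]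
  | hg i hi hi' => rw [inc_gY hinc hk hi hi']; exact hg i hi hi'
  | ht j hj hj' => rw [inc_tY hinc hk hj hj']; exact ht j hj hj'

theorem tY_comm_inc {k : ℕ} (hk : 1 ≤ k) (a : YB d k) :
    Commute (tY d (k + 1) (k + 1)) (inc k a) :=
  commute_inc hinc hk (tY_bY_comm _)
    (fun i hi hi' => (gY_tY_comm hi (by omega) (by omega) le_rfl (by omega) (by omega)).symm)
    (fun _ _ _ => tY_comm _ _) a

theorem gY_comm_inc_inc {k : ℕ} (hk : 1 ≤ k) (a : YB d k) :
    Commute (gY d (k + 2) (k + 1)) (inc (k + 1) (inc k a)) := by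
  induction a using YB_induction with
  | scalar r => simp only [AlgHom.commutes]; exact Algebra.commute_algebraMap_right r _
  | add a b ha hb => simp only [map_add]; exact ha.add_right hb
  | mul a b ha hb => simp only [map_mul]; exact ha.mul_right hb
  | hb =>
    rw [inc_bY hinc hk, inc_bY hinc (by omega)]
    exact (bY_gY_comm (by omega) (by omega)).symm
  | hg i hi hi' =>
    rw [inc_gY hinc hk hi hi', inc_gY hinc (by omega) hi (by omega)]
    exact gY_comm (by omega) (by omega) hi (by omega) (by omega)
  | ht j hj hj' =>
    rw [inc_tY hinc hk hj hj', inc_tY hinc (by omega) hj (by omega)]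
    exact gY_tY_comm (by omega) (by omega) hj (by omega) (by omega) (by omega)

end Inclusions

/-! ### The elements `b_k` and the Jucys–Murphy elements -/

/-- The Jucys–Murphy elements `g_{k-1} ⋯ g_1 b_1 g_1 ⋯ g_{k-1}`. -/
def jucysMurphy (d n : ℕ) : ℕ → YB d n
  | 0 => 1
  | 1 => bY d n
  | (k + 2) => gY d n (k + 1) * jucysMurphy d n (k + 1) * gY d n (k + 1)

section JucysMurphy

variable {d n : ℕ}

theorem tY_comm_gY_mul_mul_gY {a : YB d n} {i : ℕ} (hi : 1 ≤ i) (hi' : i ≤ n - 1)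
    (ha : ∀ j, Commute (tY d n j) a) (j : ℕ) :
    Commute (tY d n j) (gY d n i * a * gY d n i) := by
  by_cases hj : 1 ≤ j ∧ j ≤ n
  · have h : sAct i (sAct i j) = j := by unfold sAct; split_ifs <;> omega
    have h1 : 1 ≤ sAct i j ∧ sAct i j ≤ n := by unfold sAct; split_ifs <;> omega
    have h2 := semiconjBy_gY_tY (d := d) hi hi' h1.1 h1.2
    rw [h] at h2
    exact (((semiconjBy_gY_tY hi hi' hj.1 hj.2).mul_left (ha _).symm).mul_left h2).symm
  · rw [tY_eq_one hj]; exact Commute.one_left _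

theorem tY_comm_jucysMurphy {k : ℕ} (hk : k ≤ n) (j : ℕ) :
    Commute (tY d n j) (jucysMurphy d n k) := by
  induction k using jucysMurphy.induct generalizing j with
  | case1 => exact Commute.one_right _
  | case2 => exact tY_bY_comm j
  | case3 k ih =>
    exact tY_comm_gY_mul_mul_gY (by omega) (by omega) (fun j => ih (by omega) j) j

theorem jucysMurphy_comm_gY_of_lt {k i : ℕ} (hk : k < i) (hk' : 1 ≤ k) (hi : i ≤ n - 1) :
    Commute (jucysMurphy d n k) (gY d n i) := by
  induction k, hk' using Nat.le_induction with
  | base => exact bY_gY_comm hk hi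
  | succ k hk' ih =>
    obtain ⟨k, rfl⟩ := Nat.exists_eq_add_of_le' hk'
    have h : Commute (gY d n (k + 1)) (gY d n i) :=
      gY_comm (by omega) (by omega) (by omega) hi (by omega)
    exact (h.mul_left (ih (by omega))).mul_left h

theorem commute_mul_of_braid {M : Type*} [Monoid M] {a h x : M} (hx : Commute h x)
    (hb : a * h * a = h * a * h) : Commute (h * (a * x * a) * h) a :=
  calc h * (a * x * a) * h * a = h * a * x * (a * h * a) := by simp only [mul_assoc]
    _ = h * a * (x * h) * a * h := by rw [hb]; simp only [mul_assoc]
    _ = (h * a * h) * x * a * h := by rw [← hx.eq]; simp only [mul_assoc]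
    _ = a * (h * (a * x * a) * h) := by rw [← hb]; simp only [mul_assoc]

theorem jucysMurphy_comm_gY {k i : ℕ} (hi : 1 ≤ i) (hi' : i < k) (hk : k + 1 ≤ n) :
    Commute (jucysMurphy d n (k + 1)) (gY d n i) := by
  induction k with
  | zero => omega
  | succ k ih =>
    obtain rfl | h := eq_or_ne i k
    · obtain ⟨i, rfl⟩ := Nat.exists_eq_add_of_le' hi
      exact commute_mul_of_braid
        (jucysMurphy_comm_gY_of_lt (by omega) (by omega) (by omega)).symm
        (gY_braid hi (by omega))
    · have h : Commute (gY d n (k + 1)) (gY d n i) :=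
        gY_comm (by omega) (by omega) hi (by omega) (by omega)
      exact (h.mul_left (ih (by omega) (by omega))).mul_left h

theorem jucysMurphy_comm_bY {k : ℕ} (hk : k + 2 ≤ n) :
    Commute (jucysMurphy d n (k + 2)) (bY d n) := by
  induction k with
  | zero =>
    have h := bY_gY_bY_gY (d := d) (n := n)
    simp only [mul_assoc] at h
    change gY d n 1 * bY d n * gY d n 1 * bY d n = bY d n * (gY d n 1 * bY d n * gY d n 1)
    simp only [mul_assoc, h]
  | succ k ih =>
    have h : Commute (gY d n (k + 2)) (bY d n) := (bY_gY_comm (by omega) (by omega)).symm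
    exact (h.mul_left (ih (by omega))).mul_left h

end JucysMurphy

section Conjugates

variable {d n : ℕ}

theorem gY_mul_gInv {i : ℕ} (hi : 1 ≤ i) (hi' : i ≤ n - 1) : gY d n i * gInv d n i = 1 := by
  rw [gInv, mul_sub, gY_mul_self hi hi', mul_smul_comm, (gY_eY_comm hi hi').eq]
  exact add_sub_cancel_right _ _

theorem gInv_mul_gY {i : ℕ} (hi : 1 ≤ i) (hi' : i ≤ n - 1) : gInv d n i * gY d n i = 1 := by
  rw [gInv, sub_mul, gY_mul_self hi hi', smul_mul_assoc]
  exact add_sub_cancel_right _ _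

theorem semiconjBy_gInv_tY {i j : ℕ} (hi : 1 ≤ i) (hi' : i ≤ n - 1) (hj : 1 ≤ j) (hj' : j ≤ n) :
    SemiconjBy (gInv d n i) (tY d n j) (tY d n (sAct i j)) :=
  SemiconjBy.units_inv_symm_left
    (a := ⟨gY d n i, gInv d n i, gY_mul_gInv hi hi', gInv_mul_gY hi hi'⟩)
    (semiconjBy_gY_tY hi hi' hj hj')

theorem tY_comm_bk {k : ℕ} (hk : k ≤ n) (j : ℕ) : Commute (tY d n j) (bk d n k) := by
  induction k using bk.induct generalizing j with
  | case1 => exact Commute.one_right _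
  | case2 => exact tY_bY_comm j
  | case3 k ih =>
    by_cases hj : 1 ≤ j ∧ j ≤ n
    · exact (((semiconjBy_gY_tY (by omega) (by omega) hj.1 hj.2).mul_left
        (ih (by omega) _).symm).mul_left
          (semiconjBy_gInv_tY (by omega) (by omega) hj.1 hj.2)).symm
    · rw [tY_eq_one hj]; exact Commute.one_left _

theorem mul_eY_mul_mem {V : Submodule Kf (YB d n)} {a b : YB d n} {i : ℕ}
    (h : ∀ p q, a * (tY d n i ^ p * tY d n (i + 1) ^ q) * b ∈ V) : a * eY d n i * b ∈ V := by
  rw [eY_eq_sum, mul_smul_comm, smul_mul_assoc, Finset.mul_sum, Finset.sum_mul]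
  exact V.smul_mem _ (V.sum_mem fun m _ => h m _)

end Conjugates

/-! ### Spanning sets -/

/-- The span of `Y_{d,k+1} t_{k+2}^m`, `Y_{d,k+1} X t_{k+2}^m` and
`Y_{d,k+1} g_{k+1} Y_{d,k+1}` in `Y_{d,k+2}`. -/
def bimoduleSpan {d : ℕ} (inc : (k : ℕ) → (YB d k →ₐ[Kf] YB d (k + 1))) (k : ℕ)
    (X : YB d (k + 2)) : Submodule Kf (YB d (k + 2)) :=
  Submodule.span Kf {w | (∃ a m, w = inc (k + 1) a * tY d (k + 2) (k + 2) ^ m) ∨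
    (∃ a m, w = inc (k + 1) a * (X * tY d (k + 2) (k + 2) ^ m)) ∨
    ∃ a b, w = inc (k + 1) a * gY d (k + 2) (k + 1) * inc (k + 1) b}

theorem span_tY_pow_bY_eq_top (d : ℕ) :
    Submodule.span Kf {w | ∃ m, w = tY d 1 1 ^ m ∨ w = tY d 1 1 ^ m * bY d 1} = ⊤ := by
  set V := Submodule.span Kf {w | ∃ m, w = tY d 1 1 ^ m ∨ w = tY d 1 1 ^ m * bY d 1} with hV
  have ht : ∀ m, tY d 1 1 ^ m ∈ V := fun m => Submodule.subset_span ⟨m, Or.inl rfl⟩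
  have hb : ∀ m, tY d 1 1 ^ m * bY d 1 ∈ V := fun m => Submodule.subset_span ⟨m, Or.inr rfl⟩
  have key : ∀ r : YB d 1, (∀ m, tY d 1 1 ^ m * r ∈ V) → (∀ m, tY d 1 1 ^ m * bY d 1 * r ∈ V) →
      ∀ w ∈ V, w * r ∈ V := by
    intro r h h' w hw
    suffices H : V ≤ V.comap (LinearMap.mulRight Kf r) from H hw
    refine Submodule.span_le.2 ?_
    rintro _ ⟨m, rfl | rfl⟩
    · exact h m
    · exact h' m
  refine submodule_eq_top (by simpa using ht 0) (key _ hb ?_) (fun i hi hi' => by omega) ?_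
  · intro m
    rw [mul_assoc, bY_mul_self, mul_add, mul_one, mul_smul_comm, fY_eq_sum, smul_mul_assoc,
      mul_smul_comm, Finset.sum_mul, Finset.mul_sum]
    refine V.add_mem (ht m) (V.smul_mem _ (V.smul_mem _ (V.sum_mem fun p _ => ?_)))
    rw [← mul_assoc, ← pow_add]
    exact hb _
  · intro j hj hj'
    obtain rfl : j = 1 := by omega
    refine key _ (fun m => ?_) fun m => ?_
    · rw [← pow_succ]; exact ht _
    · rw [mul_assoc, ← (tY_bY_comm 1).eq, ← mul_assoc, ← pow_succ]; exact hb _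

section Spanning

variable {d : ℕ} {inc : (k : ℕ) → (YB d k →ₐ[Kf] YB d (k + 1))}

section

variable {k : ℕ} {X : YB d (k + 2)}

theorem inc_mul_tY_pow_mem (a : YB d (k + 1)) (m : ℕ) :
    inc (k + 1) a * tY d (k + 2) (k + 2) ^ m ∈ bimoduleSpan inc k X :=
  Submodule.subset_span (Or.inl ⟨a, m, rfl⟩)

theorem inc_mul_mul_tY_pow_mem (a : YB d (k + 1)) (m : ℕ) :
    inc (k + 1) a * (X * tY d (k + 2) (k + 2) ^ m) ∈ bimoduleSpan inc k X :=
  Submodule.subset_span (Or.inr (Or.inl ⟨a, m, rfl⟩))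

theorem inc_mul_gY_mul_inc_mem (a b : YB d (k + 1)) :
    inc (k + 1) a * gY d (k + 2) (k + 1) * inc (k + 1) b ∈ bimoduleSpan inc k X :=
  Submodule.subset_span (Or.inr (Or.inr ⟨a, b, rfl⟩))

/-- A linear condition holds on the span as soon as it holds on the three families. -/
theorem bimoduleSpan_le {V : Submodule Kf (YB d (k + 2))}
    (ht : ∀ a m, inc (k + 1) a * tY d (k + 2) (k + 2) ^ m ∈ V)
    (hX : ∀ a m, inc (k + 1) a * (X * tY d (k + 2) (k + 2) ^ m) ∈ V)
    (hg : ∀ a b, inc (k + 1) a * gY d (k + 2) (k + 1) * inc (k + 1) b ∈ V) :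
    bimoduleSpan inc k X ≤ V := by
  refine Submodule.span_le.2 ?_
  rintro _ (⟨a, m, rfl⟩ | ⟨a, m, rfl⟩ | ⟨a, b, rfl⟩)
  exacts [ht a m, hX a m, hg a b]

theorem inc_mul_mem (a : YB d (k + 1)) {w : YB d (k + 2)} (hw : w ∈ bimoduleSpan inc k X) :
    inc (k + 1) a * w ∈ bimoduleSpan inc k X := by
  suffices H : bimoduleSpan inc k X ≤
      (bimoduleSpan inc k X).comap (LinearMap.mulLeft Kf (inc (k + 1) a)) from H hw
  refine bimoduleSpan_le (fun b m => ?_) (fun b m => ?_) fun b c => ?_ <;>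
    simp only [Submodule.mem_comap, LinearMap.mulLeft_apply]
  · rw [← mul_assoc, ← map_mul]; exact inc_mul_tY_pow_mem _ _
  · rw [← mul_assoc, ← map_mul]; exact inc_mul_mul_tY_pow_mem _ _
  · rw [← mul_assoc, ← mul_assoc, ← map_mul]; exact inc_mul_gY_mul_inc_mem _ _

theorem mul_mem_of_forall {r : YB d (k + 2)}
    (ht : ∀ a m, inc (k + 1) a * tY d (k + 2) (k + 2) ^ m * r ∈ bimoduleSpan inc k X)
    (hX : ∀ a m, inc (k + 1) a * (X * tY d (k + 2) (k + 2) ^ m) * r ∈ bimoduleSpan inc k X)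
    (hg : ∀ a b, inc (k + 1) a * gY d (k + 2) (k + 1) * inc (k + 1) b * r ∈ bimoduleSpan inc k X) :
    ∀ w ∈ bimoduleSpan inc k X, w * r ∈ bimoduleSpan inc k X := by
  intro w hw
  suffices H : bimoduleSpan inc k X ≤ (bimoduleSpan inc k X).comap (LinearMap.mulRight Kf r) from
    H hw
  exact bimoduleSpan_le ht hX hg

end

theorem conj_mem_of_le_comap {k : ℕ} {X : YB d (k + 2)} {S : Submodule Kf (YB d (k + 1))}
    (hS : S = ⊤)
    (h : S ≤ (bimoduleSpan inc k X).comap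
      (LinearMap.mulRight Kf (gY d (k + 2) (k + 1)) ∘ₗ
        LinearMap.mulLeft Kf (gY d (k + 2) (k + 1)) ∘ₗ (inc (k + 1)).toLinearMap))
    (a : YB d (k + 1)) :
    gY d (k + 2) (k + 1) * inc (k + 1) a * gY d (k + 2) (k + 1) ∈ bimoduleSpan inc k X :=
  h (hS ▸ Submodule.mem_top : a ∈ S)

variable (hinc : ∀ k, 1 ≤ k → IsIncl d k (inc k))

include hinc

theorem inc_jucysMurphy {k j : ℕ} (hj : 1 ≤ j) (hj' : j ≤ k) :
    inc k (jucysMurphy d k j) = jucysMurphy d (k + 1) j := by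
  induction j, hj using Nat.le_induction with
  | base => exact inc_bY hinc hj'
  | succ j hj ih =>
    obtain ⟨i, rfl⟩ := Nat.exists_eq_add_of_le' hj
    simp only [jucysMurphy, map_mul, ih (by omega),
      inc_gY hinc (k := k) (i := i + 1) (by omega) (by omega) (by omega)]

theorem jucysMurphy_comm_inc (k : ℕ) (a : YB d (k + 1)) :
    Commute (jucysMurphy d (k + 2) (k + 2)) (inc (k + 1) a) :=
  commute_inc hinc (by omega) (jucysMurphy_comm_bY le_rfl)
    (fun i hi hi' => jucysMurphy_comm_gY hi (by omega) (by omega))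
    (fun j _ _ => (tY_comm_jucysMurphy le_rfl j).symm) a

theorem tY_pow_mul_gY (k m : ℕ) : tY d (k + 2) (k + 2) ^ m * gY d (k + 2) (k + 1) =
    gY d (k + 2) (k + 1) * inc (k + 1) (tY d (k + 1) (k + 1) ^ m) := by
  rw [map_pow, inc_tY hinc (by omega) (by omega) le_rfl]
  exact ((semiconjBy_gY_tY_self (by omega) (by omega)).pow_right m).eq.symm

theorem gY_mul_tY_pow (k m : ℕ) : gY d (k + 2) (k + 1) * tY d (k + 2) (k + 2) ^ m =
    inc (k + 1) (tY d (k + 1) (k + 1) ^ m) * gY d (k + 2) (k + 1) := by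
  rw [map_pow, inc_tY hinc (by omega) (by omega) le_rfl]
  exact ((semiconjBy_gY_tY_succ (by omega) (by omega)).pow_right m).eq

theorem conj_mul_tY_pow_mem {k : ℕ} {X : YB d (k + 2)} {c : YB d (k + 1)}
    (hc : Commute (gY d (k + 2) (k + 1)) (inc (k + 1) c)) (m : ℕ) :
    gY d (k + 2) (k + 1) * inc (k + 1) (c * tY d (k + 1) (k + 1) ^ m) * gY d (k + 2) (k + 1) ∈
      bimoduleSpan inc k X := by
  rw [map_mul, ← mul_assoc, hc.eq, mul_assoc, ← gY_mul_tY_pow hinc, mul_assoc,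
    ← mul_assoc (gY d (k + 2) (k + 1)), gY_mul_self (by omega) (by omega), add_mul, one_mul,
    mul_add, smul_mul_assoc, mul_smul_comm]
  refine add_mem (inc_mul_tY_pow_mem _ _) (Submodule.smul_mem _ _ ?_)
  rw [mul_assoc (eY _ _ _), ← mul_assoc, gY_mul_tY_pow hinc]
  refine mul_eY_mul_mem fun p q => ?_
  have h : inc (k + 1) c * (tY d (k + 2) (k + 1) ^ p * tY d (k + 2) (k + 2) ^ q) *
        (inc (k + 1) (tY d (k + 1) (k + 1) ^ m) * gY d (k + 2) (k + 1)) =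
      inc (k + 1) (c * tY d (k + 1) (k + 1) ^ p * tY d (k + 1) (k + 1) ^ m) *
        gY d (k + 2) (k + 1) * inc (k + 1) (tY d (k + 1) (k + 1) ^ q) := by
    have h' : tY d (k + 2) (k + 2) ^ q *
          (inc (k + 1) (tY d (k + 1) (k + 1) ^ m) * gY d (k + 2) (k + 1)) =
        inc (k + 1) (tY d (k + 1) (k + 1) ^ m) *
          (gY d (k + 2) (k + 1) * inc (k + 1) (tY d (k + 1) (k + 1) ^ q)) := by
      rw [← mul_assoc, ((tY_comm_inc hinc (by omega) _).pow_left q).eq, mul_assoc,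
        tY_pow_mul_gY hinc]
    rw [mul_assoc, mul_assoc (_ ^ p), h']
    simp only [map_mul, map_pow, inc_tY hinc (show 1 ≤ k + 1 by omega) (by omega) le_rfl,
      mul_assoc]
  rw [h]
  exact inc_mul_gY_mul_inc_mem _ _

theorem conj_mul_jucysMurphy_mem {k : ℕ} {c : YB d (k + 1)}
    (hc : Commute (gY d (k + 2) (k + 1)) (inc (k + 1) c)) (m : ℕ) :
    gY d (k + 2) (k + 1) *
        inc (k + 1) (c * (jucysMurphy d (k + 1) (k + 1) * tY d (k + 1) (k + 1) ^ m)) *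
        gY d (k + 2) (k + 1) ∈
      bimoduleSpan inc k (jucysMurphy d (k + 2) (k + 2)) := by
  have h : gY d (k + 2) (k + 1) *
        inc (k + 1) (c * (jucysMurphy d (k + 1) (k + 1) * tY d (k + 1) (k + 1) ^ m)) *
        gY d (k + 2) (k + 1) =
      inc (k + 1) c * (jucysMurphy d (k + 2) (k + 2) * tY d (k + 2) (k + 2) ^ m) := by
    rw [map_mul, map_mul, ← mul_assoc, hc.eq, inc_jucysMurphy hinc (by omega) le_rfl, mul_assoc,
      mul_assoc, mul_assoc, ← gY_mul_tY_pow hinc, jucysMurphy]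
    simp only [mul_assoc]
  rw [h]
  exact inc_mul_mul_tY_pow_mem _ _

theorem gY_mul_inc_gY_mul_gY (k : ℕ) (a b : YB d (k + 1)) :
    gY d (k + 3) (k + 2) *
        inc (k + 2) (inc (k + 1) a * gY d (k + 2) (k + 1) * inc (k + 1) b) *
        gY d (k + 3) (k + 2) =
      inc (k + 2) (inc (k + 1) a * gY d (k + 2) (k + 1)) * gY d (k + 3) (k + 2) *
        inc (k + 2) (gY d (k + 2) (k + 1) * inc (k + 1) b) := by
  have ha := gY_comm_inc_inc hinc (k := k + 1) (by omega) a
  have hb := gY_comm_inc_inc hinc (k := k + 1) (by omega) b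
  have hbr : gY d (k + 3) (k + 2) * (gY d (k + 3) (k + 1) * gY d (k + 3) (k + 2)) =
      gY d (k + 3) (k + 1) * (gY d (k + 3) (k + 2) * gY d (k + 3) (k + 1)) := by
    rw [← mul_assoc, ← mul_assoc]
    exact (gY_braid (by omega) (by omega)).symm
  simp only [map_mul, inc_gY hinc (k := k + 2) (i := k + 1) (by omega) (by omega) (by omega)]
  rw [← mul_assoc, ← mul_assoc, ha.eq, mul_assoc _ _ (gY d (k + 3) (k + 2)), ← hb.eq]
  simp only [mul_assoc]
  rw [← mul_assoc (gY d (k + 3) (k + 1)) (gY d (k + 3) (k + 2)), ← mul_assoc (gY d (k + 3) (k + 2)),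
    hbr]
  simp only [mul_assoc]

theorem bimoduleSpan_jucysMurphy_eq_top_of_conj {k : ℕ}
    (h : ∀ a : YB d (k + 1), gY d (k + 2) (k + 1) * inc (k + 1) a * gY d (k + 2) (k + 1) ∈
      bimoduleSpan inc k (jucysMurphy d (k + 2) (k + 2))) :
    bimoduleSpan inc k (jucysMurphy d (k + 2) (k + 2)) = ⊤ := by
  have ht := tY_comm_inc hinc (k := k + 1) (by omega)
  have hJ := jucysMurphy_comm_inc hinc k
  have hinc_mem : ∀ r : YB d (k + 1), ∀ w ∈ bimoduleSpan inc k (jucysMurphy d (k + 2) (k + 2)),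
      w * inc (k + 1) r ∈ bimoduleSpan inc k (jucysMurphy d (k + 2) (k + 2)) := by
    intro r
    refine mul_mem_of_forall (fun a m => ?_) (fun a m => ?_) fun a b => ?_
    · rw [mul_assoc, ((ht r).pow_left m).eq, ← mul_assoc, ← map_mul]
      exact inc_mul_tY_pow_mem _ _
    · rw [mul_assoc, ((hJ r).mul_left ((ht r).pow_left m)).eq, ← mul_assoc, ← map_mul]
      exact inc_mul_mul_tY_pow_mem _ _
    · rw [mul_assoc, ← map_mul]
      exact inc_mul_gY_mul_inc_mem _ _
  have ht_mem : ∀ w ∈ bimoduleSpan inc k (jucysMurphy d (k + 2) (k + 2)),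
      w * tY d (k + 2) (k + 2) ∈ bimoduleSpan inc k (jucysMurphy d (k + 2) (k + 2)) := by
    refine mul_mem_of_forall (fun a m => ?_) (fun a m => ?_) fun a b => ?_
    · rw [mul_assoc, ← pow_succ]
      exact inc_mul_tY_pow_mem _ _
    · rw [mul_assoc, mul_assoc, ← pow_succ]
      exact inc_mul_mul_tY_pow_mem _ _
    · have hg := gY_mul_tY_pow hinc k 1
      simp only [pow_one] at hg
      rw [mul_assoc, ← (ht b).eq, ← mul_assoc, mul_assoc (inc _ _), hg, ← mul_assoc, ← map_mul]
      exact inc_mul_gY_mul_inc_mem _ _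
  have hg_mem : ∀ w ∈ bimoduleSpan inc k (jucysMurphy d (k + 2) (k + 2)),
      w * gY d (k + 2) (k + 1) ∈ bimoduleSpan inc k (jucysMurphy d (k + 2) (k + 2)) := by
    refine mul_mem_of_forall (fun a m => ?_) (fun a m => ?_) fun a b => ?_
    · rw [mul_assoc, tY_pow_mul_gY hinc, ← mul_assoc]
      exact inc_mul_gY_mul_inc_mem _ _
    · rw [mul_assoc, mul_assoc, tY_pow_mul_gY hinc, ← mul_assoc _ (gY _ _ _)]
      refine inc_mul_mem _ (hinc_mem _ _ ?_)
      have hJg : jucysMurphy d (k + 2) (k + 2) * gY d (k + 2) (k + 1) =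
          inc (k + 1) 1 * gY d (k + 2) (k + 1) * inc (k + 1) (jucysMurphy d (k + 1) (k + 1)) +
            (uu - uu⁻¹) • (jucysMurphy d (k + 2) (k + 2) * eY d (k + 2) (k + 1) * 1) := by
        rw [inc_jucysMurphy hinc (by omega) le_rfl, jucysMurphy, mul_assoc,
          gY_mul_self (by omega) (by omega), mul_add, mul_smul_comm, map_one, mul_one, one_mul,
          mul_one, ← (gY_eY_comm (by omega) (by omega)).eq]
        simp only [mul_assoc]
      rw [hJg]
      refine add_mem (inc_mul_gY_mul_inc_mem _ _) (Submodule.smul_mem _ _ ?_)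
      refine mul_eY_mul_mem fun p q => ?_
      rw [mul_one, ← mul_assoc, ((tY_comm_jucysMurphy le_rfl _).pow_left p).eq.symm, mul_assoc,
        ← inc_tY hinc (k := k + 1) (by omega) (by omega) le_rfl, ← map_pow]
      exact inc_mul_mul_tY_pow_mem _ _
    · rw [mul_assoc, mul_assoc, ← mul_assoc (gY _ _ _)]
      exact inc_mul_mem _ (h b)
  refine submodule_eq_top ?_ ?_ (fun i hi hi' => ?_) fun j hj hj' => ?_
  · simpa using inc_mul_tY_pow_mem (inc := inc) (k := k) 1 0
  · rw [← inc_bY hinc (by omega)]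
    exact hinc_mem _
  · by_cases hik : i = k + 1
    · subst hik; exact hg_mem
    · rw [← inc_gY hinc (by omega) hi (by omega)]
      exact hinc_mem _
  · by_cases hjk : j = k + 2
    · subst hjk; exact ht_mem
    · rw [← inc_tY hinc (by omega) hj (by omega)]
      exact hinc_mem _

theorem bimoduleSpan_jucysMurphy_eq_top (k : ℕ) :
    bimoduleSpan inc k (jucysMurphy d (k + 2) (k + 2)) = ⊤ := by
  induction k with
  | zero =>
    refine bimoduleSpan_jucysMurphy_eq_top_of_conj hinc
      (conj_mem_of_le_comap (span_tY_pow_bY_eq_top d) (Submodule.span_le.2 ?_))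
    have h1 : Commute (gY d 2 1) (inc 1 1) := by rw [map_one]; exact Commute.one_right _
    rintro _ ⟨m, rfl | rfl⟩
    · have h := conj_mul_tY_pow_mem hinc (X := jucysMurphy d 2 2) h1 m
      rw [one_mul] at h
      exact h
    · have h := conj_mul_jucysMurphy_mem hinc h1 m
      rw [one_mul, ← ((tY_comm_jucysMurphy le_rfl _).pow_left m).eq] at h
      exact h
  | succ k ih =>
    have hc := gY_comm_inc_inc hinc (k := k + 1) (by omega)
    refine bimoduleSpan_jucysMurphy_eq_top_of_conj hinc
      (conj_mem_of_le_comap ih (bimoduleSpan_le (fun a m => ?_) (fun a m => ?_) fun a b => ?_))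
    · exact conj_mul_tY_pow_mem hinc (hc a) m
    · exact conj_mul_jucysMurphy_mem hinc (hc a) m
    · refine Submodule.mem_comap.2 ?_
      simp only [LinearMap.comp_apply, LinearMap.mulRight_apply, LinearMap.mulLeft_apply,
        AlgHom.toLinearMap_apply]
      rw [gY_mul_inc_gY_mul_gY hinc]
      exact inc_mul_gY_mul_inc_mem _ _

end Spanning
theorem mem_Mset_one_of {d : ℕ} (hd : 1 ≤ d) (m : ℕ) :
    tY d 1 1 ^ m ∈ Mset d 1 1 ∧ tY d 1 1 ^ m * bY d 1 ∈ Mset d 1 1 := by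
  have hm : m % d ≤ d - 1 := Nat.le_sub_one_of_lt (Nat.mod_lt m hd)
  exact ⟨⟨m % d, hm, Or.inl (tY_pow_mod 1 m).symm⟩, ⟨m % d, hm, Or.inr (by rw [tY_pow_mod])⟩⟩

section Basis

variable {d : ℕ} {inc : (k : ℕ) → (YB d k →ₐ[Kf] YB d (k + 1))}
  (hinc : ∀ k, 1 ≤ k → IsIncl d k (inc k))

include hinc

theorem gY_mul_inc_mul_eY_mem (k : ℕ) (a : YB d (k + 1)) :
    gY d (k + 2) (k + 1) * inc (k + 1) a * eY d (k + 2) (k + 1) ∈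
      Submodule.span Kf {w | ∃ a b, w = inc (k + 1) a * gY d (k + 2) (k + 1) * inc (k + 1) b} := by
  rw [← mul_one (_ * eY _ _ _)]
  refine mul_eY_mul_mem fun p q => Submodule.subset_span
    ⟨tY d (k + 1) (k + 1) ^ q, a * tY d (k + 1) (k + 1) ^ p, ?_⟩
  rw [mul_one, ← gY_mul_tY_pow hinc, ← mul_assoc, mul_assoc (gY _ _ _), mul_assoc (gY _ _ _),
    mul_assoc (gY _ _ _), ((tY_comm_inc hinc (by omega) _).pow_left q).eq]
  simp only [map_mul, map_pow, inc_tY hinc (show 1 ≤ k + 1 by omega) (by omega) le_rfl]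

theorem jucysMurphy_sub_bk_mem (k : ℕ) : jucysMurphy d (k + 2) (k + 2) - bk d (k + 2) (k + 2) ∈
    Submodule.span Kf {w | ∃ a b, w = inc (k + 1) a * gY d (k + 2) (k + 1) * inc (k + 1) b} := by
  have key (k : ℕ) : jucysMurphy d (k + 2) (k + 2) - bk d (k + 2) (k + 2) =
      gY d (k + 2) (k + 1) * inc (k + 1) (jucysMurphy d (k + 1) (k + 1) - bk d (k + 1) (k + 1)) *
        gY d (k + 2) (k + 1) + (uu - uu⁻¹) • (gY d (k + 2) (k + 1) *
          inc (k + 1) (bk d (k + 1) (k + 1)) * eY d (k + 2) (k + 1)) := by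
    rw [map_sub, inc_jucysMurphy hinc (by omega) le_rfl, inc_bk hinc (by omega) le_rfl,
      jucysMurphy, bk, gInv, mul_sub, mul_sub, sub_mul, mul_smul_comm]
    abel
  induction k with
  | zero =>
    have h : jucysMurphy d (0 + 1) (0 + 1) - bk d (0 + 1) (0 + 1) = 0 := sub_self _
    rw [key]
    refine add_mem ?_ (Submodule.smul_mem _ _ (gY_mul_inc_mul_eY_mem hinc 0 _))
    rw [h, map_zero, mul_zero, zero_mul]
    exact zero_mem _
  | succ k ih =>
    rw [key]
    refine add_mem ?_ (Submodule.smul_mem _ _ (gY_mul_inc_mul_eY_mem hinc (k + 1) _))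
    refine Submodule.span_induction ?_ ?_ (fun x y _ _ hx hy => ?_) (fun r x _ hx => ?_) ih
    · rintro _ ⟨a, b, rfl⟩
      rw [gY_mul_inc_gY_mul_gY hinc]
      exact Submodule.subset_span ⟨_, _, rfl⟩
    · rw [map_zero, mul_zero, zero_mul]
      exact zero_mem _
    · rw [map_add, mul_add, add_mul]
      exact add_mem hx hy
    · rw [map_smul, mul_smul_comm, smul_mul_assoc]
      exact Submodule.smul_mem _ _ hx

theorem bimoduleSpan_bk_eq_top (k : ℕ) : bimoduleSpan inc k (bk d (k + 2) (k + 2)) = ⊤ := by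
  rw [eq_top_iff, ← bimoduleSpan_jucysMurphy_eq_top hinc k]
  refine bimoduleSpan_le inc_mul_tY_pow_mem (fun a m => inc_mul_mem _ ?_) inc_mul_gY_mul_inc_mem
  rw [← sub_add_cancel (jucysMurphy d (k + 2) (k + 2)) (bk d (k + 2) (k + 2)), add_mul]
  refine add_mem ?_ ?_
  · refine Submodule.span_induction ?_ ?_ (fun x y _ _ hx hy => ?_) (fun r x _ hx => ?_)
      (jucysMurphy_sub_bk_mem hinc k)
    · rintro _ ⟨a, b, rfl⟩
      rw [mul_assoc, ← ((tY_comm_inc hinc (by omega) _).pow_left m).eq, ← mul_assoc,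
        mul_assoc (inc _ _), gY_mul_tY_pow hinc, ← mul_assoc, ← map_mul]
      exact inc_mul_gY_mul_inc_mem _ _
    · rw [zero_mul]
      exact zero_mem _
    · rw [add_mul]
      exact add_mem hx hy
    · rw [smul_mul_assoc]
      exact Submodule.smul_mem _ _ hx
  · simpa using inc_mul_mul_tY_pow_mem (inc := inc) (k := k) (X := bk d (k + 2) (k + 2)) 1 m

/-- `Y_{d,k+2}` is spanned by `Y_{d,k+1} M_{d,k+2}` as soon as `Y_{d,k+1}` is spanned by the
products `c x` with `x ∈ M_{d,k+1}` and `c` commuting with `g_{k+1}`. -/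
theorem span_inc_mul_Mset_of (hd : 1 ≤ d) {k : ℕ}
    (h : Submodule.span Kf {w | ∃ c, Commute (gY d (k + 2) (k + 1)) (inc (k + 1) c) ∧
      ∃ x ∈ Mset d (k + 1) (k + 1), w = c * x} = ⊤) :
    Submodule.span Kf {w | ∃ a, ∃ x ∈ Mset d (k + 2) (k + 2), w = inc (k + 1) a * x} = ⊤ := by
  have hmod : ∀ m, m % d ≤ d - 1 := fun m => Nat.le_sub_one_of_lt (Nat.mod_lt m hd)
  rw [eq_top_iff, ← bimoduleSpan_bk_eq_top hinc k]
  refine bimoduleSpan_le (fun a m => Submodule.subset_span ⟨a, _, ?_, rfl⟩)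
    (fun a m => Submodule.subset_span ⟨a, _, ?_, rfl⟩) fun a b => ?_
  · exact Or.inl ⟨m % d, hmod m, Or.inl (tY_pow_mod _ m).symm⟩
  · refine Or.inl ⟨m % d, hmod m, Or.inr ?_⟩
    rw [tY_pow_mod, ((tY_comm_bk le_rfl _).pow_left m).eq]
  · suffices H : ∀ S : Submodule Kf (YB d (k + 2)), (∀ c x,
        Commute (gY d (k + 2) (k + 1)) (inc (k + 1) c) → x ∈ Mset d (k + 1) (k + 1) →
        inc (k + 1) a * gY d (k + 2) (k + 1) * inc (k + 1) (c * x) ∈ S) →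
        inc (k + 1) a * gY d (k + 2) (k + 1) * inc (k + 1) b ∈ S by
      refine H _ fun c x hc hx => Submodule.subset_span
        ⟨a * c, gY d (k + 2) (k + 1) * inc (k + 1) x,
          Or.inr ⟨_, inc_mem_Mset hinc (by omega) le_rfl hx, rfl⟩, ?_⟩
      rw [map_mul, map_mul, ← mul_assoc, mul_assoc _ _ (inc _ c), hc.eq]
      simp only [mul_assoc]
    intro S hS
    have hb : b ∈ Submodule.span Kf {w | ∃ c, Commute (gY d (k + 2) (k + 1)) (inc (k + 1) c) ∧
      ∃ x ∈ Mset d (k + 1) (k + 1), w = c * x} := h ▸ Submodule.mem_top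
    suffices H : Submodule.span Kf {w | ∃ c, Commute (gY d (k + 2) (k + 1)) (inc (k + 1) c) ∧
      ∃ x ∈ Mset d (k + 1) (k + 1), w = c * x} ≤ S.comap (LinearMap.mulLeft Kf
        (inc (k + 1) a * gY d (k + 2) (k + 1)) ∘ₗ (inc (k + 1)).toLinearMap) from H hb
    refine Submodule.span_le.2 ?_
    rintro _ ⟨c, hc, x, hx, rfl⟩
    exact hS c x hc hx

theorem span_commute_mul_Mset (hd : 1 ≤ d) (k : ℕ) :
    Submodule.span Kf {w | ∃ c, Commute (gY d (k + 2) (k + 1)) (inc (k + 1) c) ∧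
      ∃ x ∈ Mset d (k + 1) (k + 1), w = c * x} = ⊤ := by
  induction k with
  | zero =>
    rw [eq_top_iff, ← span_tY_pow_bY_eq_top d]
    refine Submodule.span_mono ?_
    rintro _ ⟨m, rfl | rfl⟩
    · exact ⟨1, by rw [map_one]; exact Commute.one_right _, _, (mem_Mset_one_of hd m).1,
        (one_mul _).symm⟩
    · exact ⟨1, by rw [map_one]; exact Commute.one_right _, _, (mem_Mset_one_of hd m).2,
        (one_mul _).symm⟩
  | succ k ih =>
    rw [eq_top_iff, ← span_inc_mul_Mset_of hinc hd ih]
    refine Submodule.span_mono ?_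
    rintro _ ⟨a, x, hx, rfl⟩
    exact ⟨inc (k + 1) a, gY_comm_inc_inc hinc (by omega) a, x, hx, rfl⟩

theorem inc_mul_mem_Cset {k : ℕ} {c : YB d (k + 1)} {x : YB d (k + 2)}
    (hc : c ∈ Cset d (k + 1)) (hx : x ∈ Mset d (k + 2) (k + 2)) :
    inc (k + 1) c * x ∈ Cset d (k + 2) := by
  obtain ⟨f, hf, rfl⟩ := hc
  refine ⟨Fin.snoc (α := fun _ => YB d (k + 2)) (fun i => inc (k + 1) (f i)) x, fun i => ?_, ?_⟩
  · induction i using Fin.lastCases with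
    | last => rw [Fin.snoc_last]; exact hx
    | cast i => rw [Fin.snoc_castSucc]; exact inc_mem_Mset hinc (by omega) i.isLt (hf i)
  · rw [List.ofFn_succ' (n := k + 1), List.concat_eq_append, List.prod_append, Fin.snoc_last,
      map_list_prod, List.map_ofFn, List.prod_singleton]
    simp only [Fin.snoc_castSucc, Function.comp_def]

theorem span_Cset_eq_top (hd : 1 ≤ d) (k : ℕ) : Submodule.span Kf (Cset d (k + 1)) = ⊤ := by
  induction k with
  | zero =>
    rw [eq_top_iff, ← span_tY_pow_bY_eq_top d]
    refine Submodule.span_mono ?_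
    have h : ∀ x ∈ Mset d 1 1, x ∈ Cset d 1 := fun x hx =>
      ⟨fun _ => x, fun i => by rw [Subsingleton.elim i 0]; exact hx, by simp⟩
    rintro _ ⟨m, rfl | rfl⟩
    · exact h _ (mem_Mset_one_of hd m).1
    · exact h _ (mem_Mset_one_of hd m).2
  | succ k ih =>
    rw [eq_top_iff, ← span_inc_mul_Mset_of hinc hd (span_commute_mul_Mset hinc hd k)]
    refine Submodule.span_le.2 ?_
    rintro _ ⟨a, x, hx, rfl⟩
    suffices H : Submodule.span Kf (Cset d (k + 1)) ≤ (Submodule.span Kf (Cset d (k + 2))).comap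
        (LinearMap.mulRight Kf x ∘ₗ (inc (k + 1)).toLinearMap) from
      H (ih ▸ Submodule.mem_top : a ∈ Submodule.span Kf (Cset d (k + 1)))
    exact Submodule.span_le.2 fun c hc => Submodule.subset_span (inc_mul_mem_Cset hinc hc hx)

end Basis
/-! ### The sets `M_{d,k}` in terms of `𝔪^±_{k,j,m}` -/

section MonomialForms

variable {d : ℕ}

theorem gRange_succ (n : ℕ) {j k : ℕ} (h : j ≤ k) :
    gRange d n j (k + 1) = gY d n k * gRange d n j k := by
  rw [gRange, Nat.sub_add_comm h, List.range'_1_concat, List.reverse_concat', List.map_cons,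
    List.prod_cons, Nat.add_sub_cancel' h]
  rfl

theorem gRange_self (n k : ℕ) : gRange d n k k = 1 := by simp [gRange]

theorem mPlus_eq (n k j m : ℕ) : mPlus d n k j m = gRange d n j k * tY d n j ^ m := by
  unfold mPlus
  split_ifs with h
  · rw [h, gRange_self, one_mul]
  · rfl

theorem mMinus_eq {n j : ℕ} (hj : j ≤ n) (k m : ℕ) :
    mMinus d n k j m = gRange d n j k * (tY d n j ^ m * bk d n j) := by
  unfold mMinus
  split_ifs with h
  · rw [h, gRange_self, one_mul]
  · rw [((tY_comm_bk hj j).pow_left m).eq]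

theorem exists_eq_of_mem_Mset {n k : ℕ} (hk : 1 ≤ k) (hk' : k ≤ n) {a : YB d n}
    (ha : a ∈ Mset d n k) :
    ∃ j m, 1 ≤ j ∧ j ≤ k ∧ m ≤ d - 1 ∧ (a = mPlus d n k j m ∨ a = mMinus d n k j m) := by
  induction k, hk using Nat.le_induction generalizing a with
  | base =>
    obtain ⟨m, hm, rfl | rfl⟩ := ha
    · exact ⟨1, m, le_rfl, le_rfl, hm, Or.inl (by rw [mPlus, if_pos rfl])⟩
    · exact ⟨1, m, le_rfl, le_rfl, hm, Or.inr (by rw [mMinus, if_pos rfl, bk])⟩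
  | succ k hk ih =>
    obtain ⟨i, rfl⟩ := Nat.exists_eq_add_of_le' hk
    obtain ⟨m, hm, rfl | rfl⟩ | ⟨b, hb, rfl⟩ := ha
    · exact ⟨i + 2, m, by omega, le_rfl, hm, Or.inl (by rw [mPlus, if_pos rfl])⟩
    · exact ⟨i + 2, m, by omega, le_rfl, hm, Or.inr (by rw [mMinus, if_pos rfl])⟩
    · obtain ⟨j, m, hj, hj', hm, rfl | rfl⟩ := ih (by omega) hb
      · refine ⟨j, m, hj, by omega, hm, Or.inl ?_⟩
        rw [mPlus_eq, mPlus_eq, gRange_succ n hj', mul_assoc]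
      · refine ⟨j, m, hj, by omega, hm, Or.inr ?_⟩
        rw [mMinus_eq (by omega), mMinus_eq (by omega), gRange_succ n hj', mul_assoc]

variable {inc : (k : ℕ) → (YB d k →ₐ[Kf] YB d (k + 1))}
  (hinc : ∀ k, 1 ≤ k → IsIncl d k (inc k))

include hinc

theorem inc_gRange {n j k : ℕ} (hj : 1 ≤ j) (hjk : j ≤ k) (hk : k ≤ n) :
    inc n (gRange d n j k) = gRange d (n + 1) j k := by
  induction k, hjk using Nat.le_induction with
  | base => rw [gRange_self, gRange_self, map_one]
  | succ k hjk ih =>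
    rw [gRange_succ _ hjk, gRange_succ _ hjk, map_mul, ih (by omega),
      inc_gY hinc (by omega) (by omega) (by omega)]

theorem gY_mul_inc_mPlus {k j : ℕ} (hj : 1 ≤ j) (hj' : j ≤ k + 1) (m : ℕ) :
    gY d (k + 2) (k + 1) * inc (k + 1) (mPlus d (k + 1) (k + 1) j m) =
      mPlus d (k + 2) (k + 2) j m := by
  rw [mPlus_eq, mPlus_eq, map_mul, inc_gRange hinc hj hj' le_rfl, map_pow,
    inc_tY hinc (by omega) hj hj', ← mul_assoc, ← gRange_succ _ hj']

theorem gY_mul_inc_mMinus {k j : ℕ} (hj : 1 ≤ j) (hj' : j ≤ k + 1) (m : ℕ) :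
    gY d (k + 2) (k + 1) * inc (k + 1) (mMinus d (k + 1) (k + 1) j m) =
      mMinus d (k + 2) (k + 2) j m := by
  rw [mMinus_eq hj', mMinus_eq (by omega), map_mul, inc_gRange hinc hj hj' le_rfl, map_mul,
    map_pow, inc_tY hinc (by omega) hj hj', inc_bk hinc hj hj', ← mul_assoc, ← gRange_succ _ hj']

end MonomialForms

/-! ### The relative traces -/

section Trace

variable {d : ℕ} {x y : ZMod d → Kf} {inc : (k : ℕ) → (YB d k →ₐ[Kf] YB d (k + 1))}
  (hinc : ∀ k, 1 ≤ k → IsIncl d k (inc k)) (hd : 1 ≤ d)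
  {k : ℕ} {T : YB d (k + 2) →ₗ[Kf] YB d (k + 1)}
  (hT : IsRelTrace d x y (k + 1) (inc (k + 1)) T)

include hinc hd hT

theorem trace_inc_mul_tY_pow (w : YB d (k + 1)) (m : ℕ) :
    T (inc (k + 1) w * tY d (k + 2) (k + 2) ^ m) = x (m : ZMod d) • w := by
  have h : T ∘ₗ LinearMap.mulRight Kf (tY d (k + 2) (k + 2) ^ m) ∘ₗ (inc (k + 1)).toLinearMap =
      x (m : ZMod d) • LinearMap.id := by
    refine LinearMap.ext_on (span_Cset_eq_top hinc hd k) fun c hc => ?_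
    have h := (hT c hc (m % d) (Nat.le_sub_one_of_lt (Nat.mod_lt m hd))).1
    rwa [tY_pow_mod, ZMod.natCast_mod] at h
  exact LinearMap.congr_fun h w

theorem trace_inc_mul_bk_mul_tY_pow (w : YB d (k + 1)) (m : ℕ) :
    T (inc (k + 1) w * (bk d (k + 2) (k + 2) * tY d (k + 2) (k + 2) ^ m)) =
      y (m : ZMod d) • w := by
  have h : T ∘ₗ LinearMap.mulRight Kf (bk d (k + 2) (k + 2) * tY d (k + 2) (k + 2) ^ m) ∘ₗ
      (inc (k + 1)).toLinearMap = y (m : ZMod d) • LinearMap.id := by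
    refine LinearMap.ext_on (span_Cset_eq_top hinc hd k) fun c hc => ?_
    have h := (hT c hc (m % d) (Nat.le_sub_one_of_lt (Nat.mod_lt m hd))).2.1
    rwa [tY_pow_mod, ZMod.natCast_mod] at h
  exact LinearMap.congr_fun h w

theorem trace_inc_mul_gY_mul_inc (a b : YB d (k + 1)) :
    T (inc (k + 1) a * gY d (k + 2) (k + 1) * inc (k + 1) b) = zz • (a * b) := by
  have hM : ∀ a, ∀ b ∈ Mset d (k + 1) (k + 1),
      T (inc (k + 1) a * gY d (k + 2) (k + 1) * inc (k + 1) b) = zz • (a * b) := by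
    intro a b hb
    have h : T ∘ₗ LinearMap.mulRight Kf (gY d (k + 2) (k + 1) * inc (k + 1) b) ∘ₗ
        (inc (k + 1)).toLinearMap = zz • LinearMap.mulRight Kf b := by
      refine LinearMap.ext_on (span_Cset_eq_top hinc hd k) fun c hc => ?_
      obtain ⟨j, m, hj, hj', hm, rfl | rfl⟩ := exists_eq_of_mem_Mset (by omega) le_rfl hb
      · rw [gY_mul_inc_mPlus hinc hj hj']
        exact ((hT c hc m hm).2.2 j hj hj').1
      · rw [gY_mul_inc_mMinus hinc hj hj']
        exact ((hT c hc m hm).2.2 j hj hj').2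
    rw [mul_assoc]
    exact LinearMap.congr_fun h a
  have h : T ∘ₗ LinearMap.mulLeft Kf (inc (k + 1) a * gY d (k + 2) (k + 1)) ∘ₗ
      (inc (k + 1)).toLinearMap = zz • LinearMap.mulLeft Kf a := by
    refine LinearMap.ext_on (span_commute_mul_Mset hinc hd k) ?_
    rintro _ ⟨c, hc, b, hb, rfl⟩
    have h := hM (a * c) b hb
    rw [map_mul (inc _), mul_assoc _ (inc _ c), ← hc.eq, ← mul_assoc, mul_assoc _ (inc _ c),
      ← map_mul (inc _), mul_assoc a c b] at h
    exact h
  exact LinearMap.congr_fun h b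

theorem trace_tY_pow_mul_gY (a b : YB d (k + 1)) (p q : ℕ) :
    T (tY d (k + 2) (k + 1) ^ p * tY d (k + 2) (k + 2) ^ q *
        (inc (k + 1) a * gY d (k + 2) (k + 1) * inc (k + 1) b)) =
      zz • (tY d (k + 1) (k + 1) ^ p * a * tY d (k + 1) (k + 1) ^ q * b) := by
  have ha := ((tY_comm_inc hinc (by omega) a).pow_left q).eq
  rw [← inc_tY hinc (show 1 ≤ k + 1 by omega) (by omega) le_rfl, mul_assoc, ← mul_assoc (_ ^ q),
    ← mul_assoc (_ ^ q), ha, mul_assoc (inc _ a), tY_pow_mul_gY hinc,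
    mul_assoc _ _ b, ← trace_inc_mul_gY_mul_inc hinc hd hT]
  simp only [map_mul, map_pow, mul_assoc]

theorem trace_gY_mul_tY_pow (a b : YB d (k + 1)) (p q : ℕ) :
    T (inc (k + 1) a * gY d (k + 2) (k + 1) * inc (k + 1) b *
        (tY d (k + 2) (k + 1) ^ p * tY d (k + 2) (k + 2) ^ q)) =
      zz • (a * tY d (k + 1) (k + 1) ^ q * b * tY d (k + 1) (k + 1) ^ p) := by
  have hb := ((tY_comm_inc hinc (by omega) (b * tY d (k + 1) (k + 1) ^ p)).pow_left q).eq
  rw [← inc_tY hinc (show 1 ≤ k + 1 by omega) (by omega) le_rfl, ← map_pow, ← mul_assoc,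
    mul_assoc _ (inc _ b), ← map_mul, mul_assoc _ (inc _ _), ← hb, ← mul_assoc,
    mul_assoc (inc _ a), gY_mul_tY_pow hinc, ← mul_assoc, ← map_mul,
    trace_inc_mul_gY_mul_inc hinc hd hT, ← mul_assoc]

theorem trace_eY_mul_gY (X : YB d (k + 1)) :
    T (eY d (k + 2) (k + 1) * inc (k + 1) X * gY d (k + 2) (k + 1)) =
      T (gY d (k + 2) (k + 1) * inc (k + 1) X * eY d (k + 2) (k + 1)) := by
  simp only [eY_eq_sum, smul_mul_assoc, mul_smul_comm, map_smul, Finset.sum_mul, Finset.mul_sum,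
    map_sum]
  have hl (p q : ℕ) := trace_tY_pow_mul_gY hinc hd hT X 1 p q
  have hr (p q : ℕ) := trace_gY_mul_tY_pow hinc hd hT 1 X p q
  simp only [map_one, mul_one, one_mul, ← mul_assoc] at hl hr ⊢
  simp only [hl, hr]
  rw [← Finset.smul_sum, ← Finset.smul_sum, sum_range_sub_comm
    (fun p q => tY d (k + 1) (k + 1) ^ p * X * tY d (k + 1) (k + 1) ^ q)]
  simp only [tY_pow_card, pow_zero]

theorem trace_tY_mul_comm (Y : YB d (k + 2)) :
    T (tY d (k + 2) (k + 2) * Y) = T (Y * tY d (k + 2) (k + 2)) := by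
  have h : T ∘ₗ LinearMap.mulLeft Kf (tY d (k + 2) (k + 2)) =
      T ∘ₗ LinearMap.mulRight Kf (tY d (k + 2) (k + 2)) := by
    have ht := tY_comm_inc hinc (k := k + 1) (by omega)
    refine LinearMap.ext_on (bimoduleSpan_bk_eq_top hinc k) ?_
    rintro _ (⟨a, m, rfl⟩ | ⟨a, m, rfl⟩ | ⟨a, b, rfl⟩) <;>
      simp only [LinearMap.comp_apply, LinearMap.mulLeft_apply, LinearMap.mulRight_apply]
    · rw [((ht a).mul_right ((Commute.refl _).pow_right m)).eq]
    · rw [((ht a).mul_right ((tY_comm_bk le_rfl _).mul_right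
        ((Commute.refl _).pow_right m))).eq]
    · have hl := trace_tY_pow_mul_gY hinc hd hT a b 0 1
      have hr := trace_gY_mul_tY_pow hinc hd hT a b 0 1
      simp only [pow_zero, pow_one, one_mul, mul_one] at hl hr
      rw [hl, hr]
  exact LinearMap.congr_fun h Y

theorem trace_eY_mul_comm {M : Type*} [AddCommGroup M] [Module Kf M]
    (φ : YB d (k + 1) →ₗ[Kf] M)
    (hφ : ∀ X, φ (tY d (k + 1) (k + 1) * X) = φ (X * tY d (k + 1) (k + 1)))
    (Y : YB d (k + 2)) :
    φ (T (eY d (k + 2) (k + 1) * Y)) = φ (T (Y * eY d (k + 2) (k + 1))) := by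
  have hφ' (m : ℕ) : ∀ X, φ (tY d (k + 1) (k + 1) ^ m * X) = φ (X * tY d (k + 1) (k + 1) ^ m) := by
    induction m with
    | zero => simp
    | succ m ih =>
      intro X
      rw [pow_succ, mul_assoc, ih, mul_assoc, hφ, mul_assoc, ← pow_succ]
  have ht := tY_comm_inc hinc (k := k + 1) (by omega)
  have hs := (inc_tY hinc (k := k + 1) (j := k + 1) (by omega) (by omega) le_rfl).symm
  suffices h : ∀ p q, φ ∘ₗ T ∘ₗ
      LinearMap.mulLeft Kf (tY d (k + 2) (k + 1) ^ p * tY d (k + 2) (k + 2) ^ q) =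
      φ ∘ₗ T ∘ₗ LinearMap.mulRight Kf (tY d (k + 2) (k + 1) ^ p * tY d (k + 2) (k + 2) ^ q) by
    simp only [eY_eq_sum, smul_mul_assoc, mul_smul_comm, map_smul, Finset.sum_mul, Finset.mul_sum,
      map_sum]
    congr 1
    exact Finset.sum_congr rfl fun m _ => LinearMap.congr_fun (h m (d - m)) Y
  intro p q
  refine LinearMap.ext_on (bimoduleSpan_bk_eq_top hinc k) ?_
  rintro _ (⟨a, m, rfl⟩ | ⟨a, m, rfl⟩ | ⟨a, b, rfl⟩) <;>
    simp only [LinearMap.comp_apply, LinearMap.mulLeft_apply, LinearMap.mulRight_apply]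
  · have hl : tY d (k + 2) (k + 1) ^ p * tY d (k + 2) (k + 2) ^ q *
        (inc (k + 1) a * tY d (k + 2) (k + 2) ^ m) =
        inc (k + 1) (tY d (k + 1) (k + 1) ^ p * a) * tY d (k + 2) (k + 2) ^ (q + m) := by
      rw [mul_assoc, ← mul_assoc (_ ^ q), ((ht a).pow_left q).eq, hs, pow_add]
      simp only [map_mul, map_pow, mul_assoc]
    have hr : inc (k + 1) a * tY d (k + 2) (k + 2) ^ m *
        (tY d (k + 2) (k + 1) ^ p * tY d (k + 2) (k + 2) ^ q) =
        inc (k + 1) (a * tY d (k + 1) (k + 1) ^ p) * tY d (k + 2) (k + 2) ^ (q + m) := by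
      rw [((tY_comm (k + 1) (k + 2)).pow_pow p q).eq, mul_assoc, ← mul_assoc (_ ^ m), ← pow_add,
        ((tY_comm (k + 2) (k + 1)).pow_pow (m + q) p).eq, add_comm m q, hs]
      simp only [map_mul, map_pow, mul_assoc]
    rw [hl, hr, trace_inc_mul_tY_pow hinc hd hT, trace_inc_mul_tY_pow hinc hd hT, map_smul,
      map_smul, hφ']
  · have hb := tY_comm_bk (d := d) (n := k + 2) le_rfl
    have hl : tY d (k + 2) (k + 1) ^ p * tY d (k + 2) (k + 2) ^ q *
        (inc (k + 1) a * (bk d (k + 2) (k + 2) * tY d (k + 2) (k + 2) ^ m)) =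
        inc (k + 1) (tY d (k + 1) (k + 1) ^ p * a) *
          (bk d (k + 2) (k + 2) * tY d (k + 2) (k + 2) ^ (q + m)) := by
      rw [mul_assoc, ← mul_assoc (_ ^ q), ((ht a).pow_left q).eq, mul_assoc (inc _ a),
        ← mul_assoc (_ ^ q) (bk _ _ _), ((hb _).pow_left q).eq, hs, pow_add]
      simp only [map_mul, map_pow, mul_assoc]
    have hr : inc (k + 1) a * (bk d (k + 2) (k + 2) * tY d (k + 2) (k + 2) ^ m) *
        (tY d (k + 2) (k + 1) ^ p * tY d (k + 2) (k + 2) ^ q) =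
        inc (k + 1) (a * tY d (k + 1) (k + 1) ^ p) *
          (bk d (k + 2) (k + 2) * tY d (k + 2) (k + 2) ^ (q + m)) := by
      rw [((tY_comm (k + 1) (k + 2)).pow_pow p q).eq, mul_assoc, mul_assoc (bk _ _ _),
        ← mul_assoc (_ ^ m), ← pow_add, ((tY_comm (k + 2) (k + 1)).pow_pow (m + q) p).eq,
        ← mul_assoc (bk _ _ _), ← ((hb _).pow_left p).eq, add_comm m q, hs]
      simp only [map_mul, map_pow, mul_assoc]
    rw [hl, hr, trace_inc_mul_bk_mul_tY_pow hinc hd hT, trace_inc_mul_bk_mul_tY_pow hinc hd hT,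
      map_smul, map_smul, hφ']
  · rw [trace_tY_pow_mul_gY hinc hd hT, trace_gY_mul_tY_pow hinc hd hT, map_smul, map_smul,
      mul_assoc, mul_assoc, hφ']
    simp only [mul_assoc]

end Trace

theorem tY_one_comm (d : ℕ) (X : YB d 1) : Commute (tY d 1 1) X := by
  induction X using YB_induction with
  | scalar r => exact Algebra.commute_algebraMap_right r _
  | add a b ha hb => exact ha.add_right hb
  | mul a b ha hb => exact ha.mul_right hb
  | hb => exact tY_bY_comm 1
  | hg i hi hi' => omega
  | ht j _ _ => exact tY_comm 1 j

/-- here `tr k` is the relative trace `tr_{k+2} : Y_{d,k+2}^B → Y_{d,k+1}^B`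
and `tr1` is `tr_1 : Y_{d,1}^B → L`; the paper's `n ≥ 2` is `n = k + 2`:
(i) `tr_n(e_{n-1} X g_{n-1}) = tr_n(g_{n-1} X e_{n-1})` for `X ∈ Y_{d,n-1}^B`;
(ii) `tr_{n-1}(tr_n(e_{n-1} Y)) = tr_{n-1}(tr_n(Y e_{n-1}))` for `Y ∈ Y_{d,n}^B`
(the case `n = 2` uses `tr_1`). -/
theorem stmt14 (d : ℕ) (hd : 1 ≤ d)
    (x y : ZMod d → Kf) (hx0 : x 0 = 1) (hx : ∀ i, x i ≠ 0) (hy : ∀ i, y i ≠ 0)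
    (inc : (k : ℕ) → (YB d k →ₐ[Kf] YB d (k + 1))) (hinc : ∀ k, 1 ≤ k → IsIncl d k (inc k))
    (tr1 : YB d 1 →ₗ[Kf] Kf) (htr1 : IsTr1 d x y tr1)
    (tr : (k : ℕ) → (YB d (k + 2) →ₗ[Kf] YB d (k + 1)))
    (htr : ∀ k, IsRelTrace d x y (k + 1) (inc (k + 1)) (tr k)) :
    (∀ (k : ℕ) (X : YB d (k + 1)),
      tr k (eY d (k + 2) (k + 1) * inc (k + 1) X * gY d (k + 2) (k + 1)) =
      tr k (gY d (k + 2) (k + 1) * inc (k + 1) X * eY d (k + 2) (k + 1))) ∧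
    (∀ Y : YB d 2, tr1 (tr 0 (eY d 2 1 * Y)) = tr1 (tr 0 (Y * eY d 2 1))) ∧
    (∀ (k : ℕ) (Y : YB d (k + 3)),
      tr k (tr (k + 1) (eY d (k + 3) (k + 2) * Y)) =
      tr k (tr (k + 1) (Y * eY d (k + 3) (k + 2)))) := by
  exact ⟨fun k X => trace_eY_mul_gY hinc hd (htr k) X,
    fun Y => trace_eY_mul_comm hinc hd (htr 0) tr1 (fun X => by rw [(tY_one_comm d X).eq]) Y,
    fun k Y => trace_eY_mul_comm hinc hd (htr (k + 1)) (tr k)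
      (trace_tY_mul_comm hinc hd (htr k)) Y⟩
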